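/- arXiv:1001.0714 — 2 statements merged into one kernel-verified Lean document; each statement's English description precedes it below -/
import Mathlib

section
/- Let a, b > 0, let K = B₂ⁿ / vol_n(B₂ⁿ)^{1/n}, L = (1/2) B_∞ⁿ, and M_n = co[(K, −a), (L, b)] ⊆ ℝ^{n+1}. Then for every γ > 0 there is n₀ such that for all n ≥ n₀ and all s with −(√(πe) − 2)/(a√(πe) + 2b) + γ ≤ s ≤ 1/b, one has 2^{n−1} (1 − s b)^n vol_n(B₁ⁿ) ≤ vol_n(M_n^∘(s)) ≤ 2^n (1 − s b)^n vol_n(B₁ⁿ). -/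
open MeasureTheory
open scoped Pointwise RealInnerProductSpace

/-- The polar body of a subset of `ℝⁿ × ℝ = ℝ^{n+1}` (with respect to `0`). -/
def polarProd {n : ℕ} (M : Set (EuclideanSpace ℝ (Fin n) × ℝ)) :
    Set (EuclideanSpace ℝ (Fin n) × ℝ) :=
  {y | ∀ z ∈ M, ⟪y.1, z.1⟫ + y.2 * z.2 ≤ 1}

/-- `K = B₂ⁿ / vol_n(B₂ⁿ)^{1/n}`, the Euclidean ball normalized to volume `1`. -/
noncomputable def normBall (n : ℕ) : Set (EuclideanSpace ℝ (Fin n)) :=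
  ((volume (Metric.closedBall (0 : EuclideanSpace ℝ (Fin n)) 1)).toReal ^ (1 / (n : ℝ)))⁻¹ •
    Metric.closedBall (0 : EuclideanSpace ℝ (Fin n)) 1

/-- `L = (1/2) B_∞ⁿ`, the cube of volume `1`. -/
noncomputable def normCube (n : ℕ) : Set (EuclideanSpace ℝ (Fin n)) :=
  (1 / 2 : ℝ) • {x : EuclideanSpace ℝ (Fin n) | ∀ i, |x i| ≤ 1}

/-- `M_n = co[(K, -a), (L, b)] ⊆ ℝ^{n+1}`. -/
noncomputable def Mbody (a b : ℝ) (n : ℕ) : Set (EuclideanSpace ℝ (Fin n) × ℝ) :=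
  convexHull ℝ ((normBall n ×ˢ ({-a} : Set ℝ)) ∪ (normCube n ×ˢ ({b} : Set ℝ)))

/-- The section `M_n^∘(s) = {z : (z, s) ∈ M_n^∘}` of the polar body of `M_n`. -/
noncomputable def polarSection (a b : ℝ) (n : ℕ) (s : ℝ) :
    Set (EuclideanSpace ℝ (Fin n)) :=
  {z | (z, s) ∈ polarProd (Mbody a b n)}

/-- The cross-polytope `B₁ⁿ = {x : ∑|xᵢ| ≤ 1}`. -/
def B1 (n : ℕ) : Set (EuclideanSpace ℝ (Fin n)) :=
  {x | ∑ i, |x i| ≤ 1}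


/-- The `ℓ¹` norm on `Fin n → ℝ`. -/
def nn1 {n : ℕ} (x : Fin n → ℝ) : ℝ := ∑ i, |x i|

lemma nn1_cont {n : ℕ} : Continuous (nn1 : (Fin n → ℝ) → ℝ) := by
  unfold nn1; fun_prop

lemma nn1_nonneg {n : ℕ} (x : Fin n → ℝ) : 0 ≤ nn1 x :=
  Finset.sum_nonneg fun _ _ => abs_nonneg _

lemma nn1_smul {n : ℕ} (t : ℝ) (ht : 0 < t) (x : Fin n → ℝ) : nn1 (t • x) = t * nn1 x := by
  simp [nn1, abs_mul, abs_of_pos ht, Finset.mul_sum]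

/-- cross-polytope in `Fin n → ℝ`. -/
def PP (n : ℕ) : Set (Fin n → ℝ) := {x | nn1 x ≤ 1}

lemma PP_meas (n : ℕ) : MeasurableSet (PP n) :=
  (isClosed_le nn1_cont continuous_const).measurableSet

lemma PP_compact (n : ℕ) : IsCompact (PP n) := by
  refine Metric.isCompact_of_isClosed_isBounded (isClosed_le nn1_cont continuous_const) ?_
  refine (Metric.isBounded_closedBall (x := (0 : Fin n → ℝ)) (r := 1)).subset ?_
  intro x hx
  rw [mem_closedBall_zero_iff, pi_norm_le_iff_of_nonneg zero_le_one]
  intro i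
  exact (Finset.single_le_sum (f := fun i => |x i|) (fun _ _ => abs_nonneg _)
    (Finset.mem_univ i)).trans hx

lemma int_Ici_exp (c : ℝ) (N : ℝ) :
    ∫ t, (Set.Ici N).indicator (fun t => c * Real.exp (-t)) t = c * Real.exp (-N) := by
  rw [integral_indicator measurableSet_Ici, integral_Ici_eq_integral_Ioi, integral_const_mul,
    integral_exp_neg_Ioi]

lemma gamma_nat (m : ℕ) : ∫ t in Set.Ioi (0 : ℝ), Real.exp (-t) * t ^ m = (m.factorial : ℝ) := by
  rw [← Real.Gamma_nat_eq_factorial, Real.Gamma_eq_integral (by positivity)]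
  refine setIntegral_congr_fun measurableSet_Ioi fun t ht => ?_
  simp

lemma laplace_homog (n k : ℕ) (f : (Fin n → ℝ) → ℝ) (hm : Measurable f)
    (hf : ∀ (t : ℝ), 0 < t → ∀ x, f (t • x) = t ^ k * f x)
    (hi : Integrable (fun x => f x * Real.exp (-nn1 x))) :
    ∫ x, f x * Real.exp (-nn1 x) = ((n + k).factorial : ℝ) * ∫ x in PP n, f x := by
  let F : (Fin n → ℝ) → ℝ → ℝ := fun x t =>
    (Set.Ici (nn1 x)).indicator (fun t => f x * Real.exp (-t)) t
  have hF : Integrable (Function.uncurry F) (volume.prod volume) := by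
    have hmeas : Measurable (Function.uncurry F) := by
      have : Function.uncurry F = Set.indicator {p : (Fin n → ℝ) × ℝ | nn1 p.1 ≤ p.2}
          (fun p => f p.1 * Real.exp (-p.2)) := by
        ext ⟨x, t⟩
        simp [F, Set.indicator, Function.uncurry]
      rw [this]
      refine Measurable.indicator (by fun_prop) ?_
      exact (isClosed_le (nn1_cont.comp continuous_fst) continuous_snd).measurableSet
    rw [integrable_prod_iff hmeas.aestronglyMeasurable]
    constructor
    · refine Filter.Eventually.of_forall fun x => ?_
      simp only [Function.uncurry, F]
      rw [integrable_indicator_iff measurableSet_Ici, integrableOn_Ici_iff_integrableOn_Ioi]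
      exact (integrableOn_exp_neg_Ioi _).const_mul _
    · refine hi.norm.congr (Filter.Eventually.of_forall fun x => ?_)
      simp only [Function.uncurry, F, norm_indicator_eq_indicator_norm, norm_mul,
        Real.norm_eq_abs, Real.abs_exp]
      rw [int_Ici_exp]
  calc ∫ x, f x * Real.exp (-nn1 x) = ∫ x, ∫ t, F x t := by
        congr 1; ext x; exact (int_Ici_exp _ _).symm
    _ = ∫ t, ∫ x, F x t := integral_integral_swap hF
    _ = ∫ t, (Set.Ici 0).indicator (fun t => Real.exp (-t) * ∫ x, ({x | nn1 x ≤ t}).indicator f x) t := by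
        congr 1; ext t
        by_cases ht : 0 ≤ t
        · rw [Set.indicator_of_mem (by exact ht), ← integral_const_mul]
          congr 1; ext x
          simp only [F, Set.indicator, Set.mem_Ici, Set.mem_ofPred_eq]
          split_ifs <;> ring
        · rw [Set.indicator_of_notMem (by exact ht)]
          have : ∀ x, F x t = 0 := fun x => by
            refine Set.indicator_of_notMem ?_ _
            have := nn1_nonneg x
            simp only [Set.mem_Ici]; linarith
          simp [this]
    _ = ∫ t in Set.Ioi (0 : ℝ), (Real.exp (-t) * t ^ (n + k)) * ∫ x in PP n, f x := by
        rw [integral_indicator measurableSet_Ici, integral_Ici_eq_integral_Ioi]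
        refine setIntegral_congr_fun measurableSet_Ioi fun t ht => ?_
        have ht : 0 < t := ht
        have h := Measure.integral_comp_smul (volume : Measure (Fin n → ℝ))
          (({x | nn1 x ≤ t}).indicator f) t
        have h2 : ∀ x, ({x | nn1 x ≤ t}).indicator f (t • x) = t ^ k * (PP n).indicator f x := by
          intro x
          simp only [Set.indicator, Set.mem_ofPred_eq, nn1_smul t ht, PP, hf t ht]
          have : t * nn1 x ≤ t ↔ nn1 x ≤ 1 := by
            constructor
            · intro h; by_contra h'; push Not at h'; nlinarith
            · intro h; nlinarith
          simp only [this]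
          by_cases hc : nn1 x ≤ 1 <;> simp [hc]
        simp only [h2] at h
        rw [integral_const_mul, integral_indicator (PP_meas n)] at h
        simp only [Module.finrank_fin_fun, smul_eq_mul] at h
        rw [abs_of_pos (by positivity), eq_inv_mul_iff_mul_eq₀ (by positivity)] at h
        simp only [← h]
        ring
    _ = _ := by rw [integral_mul_const, gamma_nat]

lemma int_abs_pow_exp (k : ℕ) : ∫ x : ℝ, |x| ^ k * Real.exp (-|x|) = 2 * (k.factorial : ℝ) := by
  have := integral_comp_abs (f := fun x : ℝ => x ^ k * Real.exp (-x))
  rw [this, ← gamma_nat]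
  congr 2; ext; ring

lemma integrable_abs_pow_exp (k : ℕ) : Integrable fun x : ℝ => |x| ^ k * Real.exp (-|x|) := by
  by_contra h
  have := integral_undef h
  rw [int_abs_pow_exp] at this
  have h2 : (0 : ℝ) < k.factorial := by exact_mod_cast k.factorial_pos
  linarith

lemma prod_form {n : ℕ} (k : Fin n → ℕ) (x : Fin n → ℝ) :
    (∏ i, |x i| ^ k i) * Real.exp (-nn1 x) = ∏ i, (|x i| ^ k i * Real.exp (-|x i|)) := by
  rw [Finset.prod_mul_distrib, ← Real.exp_sum, nn1, Finset.sum_neg_distrib]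

lemma moment (n : ℕ) (k : Fin n → ℕ) :
    ∫ x in PP n, ∏ i, |x i| ^ k i =
      2 ^ n * (∏ i, ((k i).factorial : ℝ)) / ((n + ∑ i, k i).factorial : ℝ) := by
  have h := laplace_homog n (∑ i, k i) (fun x => ∏ i, |x i| ^ k i) (by fun_prop)
    (by
      intro t ht x
      simp only [Pi.smul_apply, smul_eq_mul, abs_mul, abs_of_pos ht, mul_pow,
        Finset.prod_mul_distrib, Finset.prod_pow_eq_pow_sum])
    (by
      simp only [prod_form]
      exact Integrable.fintype_prod fun i => integrable_abs_pow_exp (k i))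
  simp only [prod_form] at h
  rw [integral_fintype_prod_volume_eq_prod (fun i (x : ℝ) => |x| ^ k i * Real.exp (-|x|))] at h
  simp only [int_abs_pow_exp, Finset.prod_mul_distrib, Finset.prod_const, Finset.card_univ,
    Fintype.card_fin] at h
  rw [h]
  field_simp

lemma vol_PP (n : ℕ) : volume.real (PP n) = 2 ^ n / (n.factorial : ℝ) := by
  have := moment n 0
  simpa using this

lemma mom4 (n : ℕ) (i j : Fin n) :
    ∫ x in PP n, x i ^ 2 * x j ^ 2 =
      2 ^ n * (if i = j then 24 else 4) / ((n + 4).factorial : ℝ) := by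
  have := moment n (Pi.single i 2 + Pi.single j 2)
  have h1 : ∀ x : Fin n → ℝ, ∏ l, |x l| ^ ((Pi.single i 2 + Pi.single j 2 : Fin n → ℕ) l)
      = x i ^ 2 * x j ^ 2 := by
    intro x
    have : ∀ i : Fin n, ∏ l, |x l| ^ ((Pi.single i 2 : Fin n → ℕ) l) = x i ^ 2 := by
      intro i
      rw [Finset.prod_eq_single i]
      · simp
      · intro b _ hb; simp [hb]
      · simp
    simp only [Pi.add_apply, pow_add, Finset.prod_mul_distrib, this]
  have h2 : ∑ l, ((Pi.single i 2 + Pi.single j 2 : Fin n → ℕ) l) = 4 := by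
    simp [Finset.sum_add_distrib]
  have h3 : ∏ l, (((Pi.single i 2 + Pi.single j 2 : Fin n → ℕ) l).factorial : ℝ)
      = if i = j then 24 else 4 := by
    split_ifs with hij
    · subst hij
      rw [Finset.prod_eq_single i]
      · simp [Nat.factorial]
      · intro b _ hb; simp [hb]
      · simp
    · rw [Finset.prod_eq_mul i j hij]
      · simp [hij, Ne.symm hij]; try norm_num
      · intro b _ hb; simp [hb.1, hb.2]
      · simp
      · simp
  simp only [h1, h2, h3] at this
  exact this

lemma mom2 (n : ℕ) (i : Fin n) :
    ∫ x in PP n, x i ^ 2 = 2 ^ n * 2 / ((n + 2).factorial : ℝ) := by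
  have := moment n (Pi.single i 2)
  have h1 : ∀ x : Fin n → ℝ, ∏ l, |x l| ^ ((Pi.single i 2 : Fin n → ℕ) l) = x i ^ 2 := by
    intro x
    rw [Finset.prod_eq_single i]
    · simp
    · intro b _ hb; simp [hb]
    · simp
  have h3 : ∏ l, (((Pi.single i 2 : Fin n → ℕ) l).factorial : ℝ) = 2 := by
    rw [Finset.prod_eq_single i]
    · simp
    · intro b _ hb; simp [hb]
    · simp
  simp only [h1, h3] at this
  simpa using this

/-- squared Euclidean norm -/
def QQ {n : ℕ} (x : Fin n → ℝ) : ℝ := ∑ i, x i ^ 2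

lemma QQ_cont {n : ℕ} : Continuous (QQ : (Fin n → ℝ) → ℝ) := by
  unfold QQ; fun_prop

lemma int_cont {n : ℕ} {f : (Fin n → ℝ) → ℝ} (hf : Continuous f) : IntegrableOn f (PP n) :=
  hf.continuousOn.integrableOn_compact (PP_compact n)

lemma momQ (n : ℕ) : ∫ x in PP n, QQ x = n * (2 ^ n * 2 / ((n + 2).factorial : ℝ)) := by
  unfold QQ
  rw [integral_finsetSum]
  · simp [mom2]
  · intro i _; exact int_cont (by fun_prop)

lemma momQ2 (n : ℕ) : ∫ x in PP n, QQ x ^ 2 =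
    2 ^ n * (4 * n ^ 2 + 20 * n) / ((n + 4).factorial : ℝ) := by
  have : ∀ x : Fin n → ℝ, QQ x ^ 2 = ∑ i, ∑ j, x i ^ 2 * x j ^ 2 := by
    intro x; rw [QQ, sq, Finset.sum_mul_sum]
  simp only [this]
  rw [integral_finsetSum]
  · have : ∀ i, ∫ x in PP n, ∑ j, x i ^ 2 * x j ^ 2 =
        2 ^ n * (4 * n + 20) / ((n + 4).factorial : ℝ) := by
      intro i
      rw [integral_finsetSum]
      · simp only [mom4, ← Finset.sum_div, ← Finset.mul_sum]
        have : ∀ j : Fin n, (if i = j then (24 : ℝ) else 4) = 4 + if i = j then 20 else 0 := by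
          intro j; split_ifs <;> norm_num
        simp only [this, Finset.sum_add_distrib]
        simp
        ring
      · intro j _; exact int_cont (by fun_prop)
    simp only [this]
    simp
    ring
  · intro i _; exact int_cont (by fun_prop)

lemma var_bound (n : ℕ) (hn : 0 < n) :
    ∫ x in PP n, (QQ x - 2 / n) ^ 2 ≤ volume.real (PP n) * (24 / n ^ 3) := by
  have h : ∀ x : Fin n → ℝ, (QQ x - 2 / n) ^ 2 = QQ x ^ 2 - (4 / n) * QQ x + (2 / n) ^ 2 := by
    intro x; ring
  have h1 : IntegrableOn (fun x : Fin n → ℝ => QQ x ^ 2) (PP n) := int_cont (QQ_cont.pow 2)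
  have h2 : IntegrableOn (fun x : Fin n → ℝ => (4 / (n:ℝ)) * QQ x) (PP n) :=
    int_cont (continuous_const.mul QQ_cont)
  have h3 : IntegrableOn (fun x : Fin n → ℝ => (2 / (n:ℝ)) ^ 2) (PP n) := int_cont continuous_const
  simp only [h]
  have h12 : IntegrableOn (fun x : Fin n → ℝ => QQ x ^ 2 - 4 / (n:ℝ) * QQ x) (PP n) := h1.sub h2
  rw [integral_add h12 h3,
    integral_sub h1 h2, integral_const_mul, momQ, momQ2]
  simp only [integral_const, smul_eq_mul, measureReal_restrict_apply_univ]
  rw [vol_PP]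
  have e2 : ((n + 2).factorial : ℝ) = (n + 2) * ((n + 1) * n.factorial) := by
    simp only [Nat.factorial_succ]; push_cast; ring
  have e4 : ((n + 4).factorial : ℝ) = (n + 4) * ((n + 3) * ((n + 2) * ((n + 1) * n.factorial))) := by
    simp only [Nat.factorial_succ]; push_cast; ring
  rw [e2, e4]
  have hn' : (0 : ℝ) < n := by exact_mod_cast hn
  have hfac : (0 : ℝ) < n.factorial := by exact_mod_cast n.factorial_pos
  set N : ℝ := (n : ℝ)
  have key : (4 * N ^ 2 + 20 * N) / ((N + 4) * ((N + 3) * ((N + 2) * (N + 1))))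
      - (4 / N) * (N * 2 / ((N + 2) * (N + 1))) + (2 / N) ^ 2 ≤ 24 / N ^ 3 := by
    have a1 : (4 * N ^ 2 + 20 * N) / ((N + 4) * ((N + 3) * ((N + 2) * (N + 1)))) ≤ 4 / N ^ 2 := by
      rw [div_le_div_iff₀ (by positivity) (by positivity)]
      nlinarith [pow_pos hn' 2, pow_pos hn' 3]
    have a2 : 8 / N ^ 2 - 24 / N ^ 3 ≤ (4 / N) * (N * 2 / ((N + 2) * (N + 1))) := by
      have : (4 / N) * (N * 2 / ((N + 2) * (N + 1))) - (8 / N ^ 2 - 24 / N ^ 3)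
        = (8 * (7 * N + 6)) / (N ^ 3 * ((N + 2) * (N + 1))) := by
        field_simp; ring
      have : 0 ≤ (8 * (7 * N + 6)) / (N ^ 3 * ((N + 2) * (N + 1))) := by positivity
      linarith
    have a3 : (2 / N) ^ 2 = 4 / N ^ 2 := by ring
    have a4 : 8 / N ^ 2 = 4 / N ^ 2 + 4 / N ^ 2 := by ring
    linarith
  calc _ = 2 ^ n / (n.factorial : ℝ) * ((4 * N ^ 2 + 20 * N) / ((N + 4) * ((N + 3) * ((N + 2) * (N + 1))))
      - (4 / N) * (N * 2 / ((N + 2) * (N + 1))) + (2 / N) ^ 2) := by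
        field_simp
    _ ≤ _ := by gcongr

lemma half_mass (n : ℕ) (hn : 0 < n) (δ : ℝ) (hδ : 0 < δ) (hnδ : 12 / δ ^ 2 ≤ n) (r : ℝ)
    (hr : (1 + δ) * (2 / n) ≤ r) :
    volume.real (PP n) / 2 ≤ volume.real (PP n ∩ {x | QQ x ≤ r}) := by
  have hn' : (0 : ℝ) < n := by exact_mod_cast hn
  have hfin : volume (PP n) ≠ ⊤ := (PP_compact n).measure_lt_top.ne
  have hmeas : MeasurableSet {x : Fin n → ℝ | QQ x ≤ r} :=
    (isClosed_le QQ_cont continuous_const).measurableSet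
  have hsplit := measureReal_inter_add_sdiff (μ := volume) (s := PP n) hmeas hfin
  have hc : 0 < (δ * (2 / n)) ^ 2 := by positivity
  have hmk := mul_meas_ge_le_integral_of_nonneg (μ := volume.restrict (PP n))
    (f := fun x => (QQ x - 2 / n) ^ 2) (Filter.Eventually.of_forall fun x => sq_nonneg _)
    (int_cont ((QQ_cont.sub continuous_const).pow 2)) ((δ * (2 / n)) ^ 2)
  have hle : volume.real (PP n \ {x | QQ x ≤ r}) ≤
      (volume.restrict (PP n)).real {x | (δ * (2 / n)) ^ 2 ≤ (QQ x - 2 / n) ^ 2} := by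
    have hm2 : MeasurableSet {x : Fin n → ℝ | (δ * (2 / n)) ^ 2 ≤ (QQ x - 2 / n) ^ 2} :=
      (isClosed_le continuous_const ((QQ_cont.sub continuous_const).pow 2)).measurableSet
    rw [measureReal_restrict_apply hm2]
    refine measureReal_mono ?_ (measure_ne_top_of_subset Set.inter_subset_right hfin)
    rintro x ⟨hx, hx2⟩
    refine ⟨?_, hx⟩
    simp only [Set.mem_ofPred_eq, not_le] at hx2 ⊢
    have : 0 < δ * (2 / (n:ℝ)) := by positivity
    apply pow_le_pow_left₀ this.le
    linarith
  have hV : 0 ≤ volume.real (PP n) := measureReal_nonneg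
  have h1 := (mul_le_mul_of_nonneg_left hle hc.le).trans (hmk.trans (var_bound n hn))
  have h2 : 24 / (n:ℝ) ^ 3 ≤ (δ * (2 / n)) ^ 2 * (1 / 2) := by
    rw [div_le_iff₀ (by positivity)] at hnδ ⊢
    have : (δ * (2 / (n:ℝ))) ^ 2 * (1 / 2) * n ^ 3 = 2 * (n * δ ^ 2) := by field_simp
    rw [this]; linarith
  have h3 : (δ * (2 / n)) ^ 2 * volume.real (PP n \ {x | QQ x ≤ r}) ≤
      (δ * (2 / n)) ^ 2 * (volume.real (PP n) / 2) := by
    nlinarith [mul_le_mul_of_nonneg_left h2 hV]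
  have h4 := le_of_mul_le_mul_left h3 hc
  linarith

lemma gamma_bound (x c : ℝ) (hx : 0 < x) (hc : 0 < c) (hc1 : c < 1) :
    Real.Gamma (x + 1) ≤ (x / c) ^ x * Real.exp (-x) * (1 - c)⁻¹ := by
  rw [Real.Gamma_eq_integral (by linarith)]
  have hI : IntegrableOn (fun t : ℝ => Real.exp (-(1 - c) * t)) (Set.Ioi 0) :=
    integrableOn_exp_mul_Ioi (by linarith) 0
  have hval : ∫ t in Set.Ioi (0:ℝ), Real.exp (-(1 - c) * t) = (1 - c)⁻¹ := by
    rw [integral_exp_mul_Ioi (by linarith)]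
    simp [neg_div]
    rw [← inv_neg]
    congr 1
    ring
  rw [← hval, ← integral_const_mul]
  refine setIntegral_mono_on (Real.GammaIntegral_convergent (by linarith)) (hI.const_mul _)
    measurableSet_Ioi fun t ht => ?_
  have ht : 0 < t := ht
  have h1 : c * t / x ≤ Real.exp (c * t / x - 1) := by
    have := Real.add_one_le_exp (c * t / x - 1); linarith
  have h2 : (c * t / x) ^ x ≤ Real.exp (c * t - x) := by
    have := Real.rpow_le_rpow (by positivity) h1 hx.le
    rw [← Real.exp_mul] at this
    convert this using 2
    field_simp
  have h3 : t ^ x = (x / c) ^ x * (c * t / x) ^ x := by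
    rw [← Real.mul_rpow (by positivity) (by positivity)]
    congr 1; field_simp
  rw [add_sub_cancel_right, h3]
  calc Real.exp (-t) * ((x / c) ^ x * (c * t / x) ^ x)
      ≤ Real.exp (-t) * ((x / c) ^ x * Real.exp (c * t - x)) := by gcongr
    _ = (x / c) ^ x * (Real.exp (-t) * Real.exp (c * t - x)) := by ring
    _ = (x / c) ^ x * (Real.exp (-x) * Real.exp (-(1 - c) * t)) := by
        rw [← Real.exp_add, ← Real.exp_add]; congr 2; ring
    _ = _ := by ring

lemma vol_ball_root (ρ : ℝ) (hρ : 0 < ρ) (hρ1 : ρ < 1) : ∃ n₀ : ℕ, ∀ n ≥ n₀, 0 < n ∧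
    ρ * Real.sqrt (2 * (Real.pi * Real.exp 1) / n) ≤
      (volume (Metric.closedBall (0 : EuclideanSpace ℝ (Fin n)) 1)).toReal ^ (1 / (n : ℝ)) := by
  set q := (1 + ρ) / 2 with hq
  have hq0 : 0 < q := by positivity
  have hq1 : q < 1 := by rw [hq]; linarith
  have hρq : ρ < q := by rw [hq]; linarith
  have hq2 : 0 < 1 - q ^ 2 := by nlinarith
  obtain ⟨n₁, hn₁⟩ := exists_pow_lt_of_lt_one hq2 ((div_lt_one hq0).2 hρq)
  refine ⟨n₁ + 1, fun n hn => ?_⟩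
  have hn0 : 0 < n := by omega
  refine ⟨hn0, ?_⟩
  have hn' : (0 : ℝ) < n := by exact_mod_cast hn0
  have : Nonempty (Fin n) := ⟨⟨0, hn0⟩⟩
  have hpow : (ρ / q) ^ n ≤ 1 - q ^ 2 :=
    (pow_le_pow_of_le_one (by positivity) ((div_lt_one hq0).2 hρq).le (by omega)).trans hn₁.le
  have hG : 0 < Real.Gamma ((n:ℝ) / 2 + 1) := Real.Gamma_pos_of_pos (by positivity)
  have hv : (volume (Metric.closedBall (0 : EuclideanSpace ℝ (Fin n)) 1)).toReal =
      Real.sqrt Real.pi ^ n / Real.Gamma ((n:ℝ) / 2 + 1) := by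
    rw [EuclideanSpace.volume_closedBall]
    simp only [ENNReal.ofReal_one, one_pow, one_mul, Fintype.card_fin]
    exact ENNReal.toReal_ofReal (by positivity)
  have hgb := gamma_bound ((n:ℝ) / 2) (q ^ 2) (by positivity) (by positivity) (by nlinarith)
  have hsq : ((n:ℝ) / 2 / q ^ 2) ^ ((n:ℝ) / 2) * Real.exp (-((n:ℝ) / 2)) =
      Real.sqrt ((n:ℝ) / 2 / q ^ 2 / Real.exp 1) ^ n := by
    rw [← Real.rpow_natCast _ n, Real.sqrt_eq_rpow, ← Real.rpow_mul (by positivity),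
      Real.div_rpow (x := (n:ℝ) / 2 / q ^ 2) (y := Real.exp 1) (by positivity) (by positivity),
      Real.exp_one_rpow, Real.exp_neg]
    rw [show (1 / 2 : ℝ) * n = n / 2 by ring]
    rfl
  rw [hsq] at hgb
  have hmain : (ρ * Real.sqrt (2 * (Real.pi * Real.exp 1) / n)) ^ n ≤
      (volume (Metric.closedBall (0 : EuclideanSpace ℝ (Fin n)) 1)).toReal := by
    rw [hv, le_div_iff₀ hG]
    have hS : Real.sqrt (2 * (Real.pi * Real.exp 1) / n) *
        Real.sqrt ((n:ℝ) / 2 / q ^ 2 / Real.exp 1) = Real.sqrt Real.pi / q := by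
      rw [← Real.sqrt_mul (by positivity)]
      rw [show 2 * (Real.pi * Real.exp 1) / n * ((n:ℝ) / 2 / q ^ 2 / Real.exp 1)
        = Real.pi / q ^ 2 by field_simp]
      rw [Real.sqrt_div Real.pi_pos.le, Real.sqrt_sq hq0.le]
    calc _ ≤ (ρ * Real.sqrt (2 * (Real.pi * Real.exp 1) / n)) ^ n *
          (Real.sqrt ((n:ℝ) / 2 / q ^ 2 / Real.exp 1) ^ n * (1 - q ^ 2)⁻¹) := by gcongr
      _ = (ρ * (Real.sqrt (2 * (Real.pi * Real.exp 1) / n) *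
          Real.sqrt ((n:ℝ) / 2 / q ^ 2 / Real.exp 1))) ^ n * (1 - q ^ 2)⁻¹ := by
          rw [← mul_assoc, ← mul_pow, mul_assoc]
      _ = Real.sqrt Real.pi ^ n * ((ρ / q) ^ n * (1 - q ^ 2)⁻¹) := by
          rw [hS, show ρ * (Real.sqrt Real.pi / q) = Real.sqrt Real.pi * (ρ / q) by ring, mul_pow]
          ring
      _ ≤ Real.sqrt Real.pi ^ n * 1 := by
          gcongr
          rw [← div_eq_mul_inv]
          exact (div_le_one hq2).2 hpow
      _ = _ := mul_one _
  have := Real.rpow_le_rpow (by positivity) hmain (z := 1 / (n:ℝ)) (by positivity)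
  rwa [one_div, Real.pow_rpow_inv_natCast (by positivity) hn0.ne', ← one_div] at this

lemma section_subset (a b : ℝ) (n : ℕ) (s : ℝ) (hs : 0 ≤ 1 - s * b) :
    polarSection a b n s ⊆ (2 * (1 - s * b)) • B1 n := by
  intro z hz
  have hz1 : ∑ i, |z i| ≤ 2 * (1 - s * b) := by
    let x : EuclideanSpace ℝ (Fin n) := WithLp.toLp 2 fun i => (SignType.sign (z i) : ℝ)
    have hx : (1 / 2 : ℝ) • x ∈ normCube n := by
      refine Set.smul_mem_smul_set ?_
      intro i
      simp only [x]
      rcases lt_trichotomy (z i) 0 with h | h | h <;> simp [h]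
    have := hz ((1 / 2 : ℝ) • x, b) (subset_convexHull _ _ (Or.inr ⟨hx, rfl⟩))
    simp only [inner_smul_right] at this
    have h2 : ⟪z, x⟫ = ∑ i, |z i| := by
      simp only [PiLp.inner_apply, x]
      refine Finset.sum_congr rfl fun i _ => ?_
      simp
    rw [h2] at this
    linarith
  rcases hs.eq_or_lt with h | h
  · rw [← h, mul_zero] at hz1 ⊢
    have : z = 0 := by
      ext i
      have := (Finset.sum_eq_zero_iff_of_nonneg (fun i _ => abs_nonneg (z i))).1
        (le_antisymm hz1 (Finset.sum_nonneg fun i _ => abs_nonneg (z i))) i (Finset.mem_univ i)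
      simpa using this
    rw [this]
    exact ⟨0, by simp [B1], by simp⟩
  · rw [Set.mem_smul_set_iff_inv_smul_mem₀ (by positivity)]
    have hp : 0 < 2 * (1 - s * b) := by positivity
    simp only [B1, Set.mem_ofPred_eq, PiLp.smul_apply, smul_eq_mul, abs_mul, ← Finset.mul_sum,
      abs_of_pos (inv_pos.2 hp)]
    rw [inv_mul_le_iff₀ hp]; linarith

lemma subset_section (a b : ℝ) (n : ℕ) (s : ℝ) (w : ℝ) (hw : 0 < w)
    (hwdef : w = (volume (Metric.closedBall (0 : EuclideanSpace ℝ (Fin n)) 1)).toReal ^ (1 / (n : ℝ)))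
    (z : EuclideanSpace ℝ (Fin n)) (h2 : ‖z‖ ≤ (1 + s * a) * w)
    (h1 : ∑ i, |z i| ≤ 2 * (1 - s * b)) : z ∈ polarSection a b n s := by
  intro y hy
  have hconv : Convex ℝ {y : EuclideanSpace ℝ (Fin n) × ℝ | ⟪z, y.1⟫ + s * y.2 ≤ 1} := by
    refine convex_halfSpace_le (f := fun y : EuclideanSpace ℝ (Fin n) × ℝ => ⟪z, y.1⟫ + s * y.2)
      ⟨?_, ?_⟩ 1
    · intro x y; simp [inner_add_right]; ring
    · intro c x; simp [inner_smul_right]; ring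
  refine convexHull_min ?_ hconv hy
  rintro ⟨x, t⟩ (⟨hx, ht⟩ | ⟨hx, ht⟩)
  · simp only [Set.mem_singleton_iff] at ht
    subst ht
    obtain ⟨x', hx', rfl⟩ := hx
    rw [← hwdef]
    rw [mem_closedBall_zero_iff] at hx'
    have := real_inner_le_norm z x'
    simp only [Set.mem_ofPred_eq, inner_smul_right]
    have h3 : ⟪z, x'⟫ ≤ (1 + s * a) * w := by
      nlinarith [norm_nonneg z, norm_nonneg x']
    have h4 : w⁻¹ * ⟪z, x'⟫ ≤ 1 + s * a := by
      rw [inv_mul_le_iff₀ hw]; linarith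
    linarith
  · simp only [Set.mem_singleton_iff] at ht
    subst ht
    obtain ⟨x', hx', rfl⟩ := hx
    simp only [Set.mem_ofPred_eq, inner_smul_right]
    have h3 : ⟪z, x'⟫ ≤ ∑ i, |z i| := by
      rw [PiLp.inner_apply]
      refine Finset.sum_le_sum fun i _ => ?_
      have h5 : |x' i| ≤ 1 := hx' i
      calc ⟪z i, x' i⟫ ≤ |z i| * |x' i| := by
            have := real_inner_le_norm (z i) (x' i)
            simpa using this
        _ ≤ |z i| * 1 := by gcongr
        _ = |z i| := mul_one _
    linarith

lemma vol_B1 (n : ℕ) : volume (B1 n) = volume (PP n) := by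
  have := (EuclideanSpace.volume_preserving_symm_measurableEquiv_toLp (Fin n)).measure_preimage
    (PP_meas n).nullMeasurableSet
  rw [← this]
  rfl

lemma vol_B1r (n : ℕ) (r : ℝ) : volume (B1 n ∩ {x | ‖x‖ ^ 2 ≤ r}) =
    volume (PP n ∩ {x | QQ x ≤ r}) := by
  have := (EuclideanSpace.volume_preserving_symm_measurableEquiv_toLp (Fin n)).measure_preimage
    (s := PP n ∩ {x | QQ x ≤ r}) ((PP_meas n).inter
      (isClosed_le QQ_cont continuous_const).measurableSet).nullMeasurableSet
  rw [← this]
  congr 1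
  ext x
  simp only [Set.mem_inter_iff, Set.mem_ofPred_eq, Set.mem_preimage, EuclideanSpace.norm_sq_eq,
    Real.norm_eq_abs, sq_abs]
  rfl

theorem polarSection_volume_near_cube_face (a b : ℝ) (ha : 0 < a) (hb : 0 < b) :
    ∀ γ > (0 : ℝ), ∃ n₀ : ℕ, ∀ n ≥ n₀, ∀ s : ℝ,
      -(Real.sqrt (Real.pi * Real.exp 1) - 2) /
          (a * Real.sqrt (Real.pi * Real.exp 1) + 2 * b) + γ ≤ s → s ≤ 1 / b →
      (2 : ℝ) ^ ((n : ℝ) - 1) * (1 - s * b) ^ n * (volume (B1 n)).toReal ≤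
          (volume (polarSection a b n s)).toReal ∧
        (volume (polarSection a b n s)).toReal ≤
          (2 : ℝ) ^ n * (1 - s * b) ^ n * (volume (B1 n)).toReal := by
  intro γ hγ
  set E := Real.sqrt (Real.pi * Real.exp 1) with hE
  have hE0 : 0 < E := by rw [hE]; positivity
  set D := a * E + 2 * b with hD
  have hD0 : 0 < D := by positivity
  set s₀ := -(E - 2) / D with hs₀
  have hs₀D : s₀ * D = -(E - 2) := by rw [hs₀]; field_simp
  set T := 1 - s₀ * b with hT
  have hT0 : 0 < T := by
    have : T * D = (a + b) * E := by
      calc T * D = D - (s₀ * D) * b := by rw [hT]; ring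
        _ = _ := by rw [hs₀D, hD]; ring
    have h : 0 < T * D := by rw [this]; positivity
    exact pos_of_mul_pos_left h hD0.le
  set η := γ * D / (2 * T) with hη
  have hη0 : 0 < η := by positivity
  obtain ⟨n₁, hn₁⟩ := vol_ball_root (1 / Real.sqrt (1 + η)) (by positivity) (by
    rw [div_lt_one (by positivity)]
    exact Real.lt_sqrt_of_sq_lt (by linarith))
  obtain ⟨n₂, hn₂⟩ := exists_nat_ge (12 / η ^ 2)
  refine ⟨max n₁ n₂, fun n hn s hs1 hs2 => ?_⟩
  obtain ⟨hn0, hw⟩ := hn₁ n (le_of_max_le_left hn)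
  have hnn : 12 / η ^ 2 ≤ n := hn₂.trans (by exact_mod_cast le_of_max_le_right hn)
  have hn' : (0 : ℝ) < n := by exact_mod_cast hn0
  have hT1 : 0 ≤ 1 - s * b := by
    rw [le_div_iff₀ hb] at hs2; linarith
  have hVfin : volume (B1 n) ≠ ⊤ := by rw [vol_B1]; exact (PP_compact n).measure_lt_top.ne
  have hsc : ∀ A : Set (EuclideanSpace ℝ (Fin n)), volume ((2 * (1 - s * b)) • A) =
      ENNReal.ofReal ((2 * (1 - s * b)) ^ n) * volume A := by
    intro A
    rw [Measure.addHaar_smul]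
    simp only [finrank_euclideanSpace, Fintype.card_fin]
    rw [abs_of_nonneg (by positivity)]
  have hscfin : volume ((2 * (1 - s * b)) • B1 n) ≠ ⊤ := by
    rw [hsc]; exact ENNReal.mul_ne_top ENNReal.ofReal_ne_top hVfin
  constructor
  · rcases hT1.eq_or_lt with h | h
    · rw [← h]; simp [hn0.ne']
    · set w := (volume (Metric.closedBall (0 : EuclideanSpace ℝ (Fin n)) 1)).toReal ^ (1 / (n : ℝ))
        with hwdef
      have hw0 : 0 < w := lt_of_lt_of_le (by positivity) hw
      set r : ℝ := (1 + η) * (2 / n) with hr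
      have hlin : (1 + η) * (2 * (1 - s * b)) ≤ (1 + s * a) * E := by
        have e1 : (1 + s * a) * E - 2 * (1 - s * b) = (s - s₀) * D := by
          calc _ = s * D - (-(E - 2)) := by rw [hD]; ring
            _ = _ := by rw [← hs₀D]; ring
        have e2 : η * (2 * T) = γ * D := by rw [hη]; field_simp
        have e3 : 1 - s * b ≤ T := by rw [hT]; nlinarith
        nlinarith
      have hnorm : ∀ y : EuclideanSpace ℝ (Fin n), ‖y‖ ^ 2 ≤ r →
          2 * (1 - s * b) * ‖y‖ ≤ (1 + s * a) * w := by
        intro y hy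
        have hsa : 0 < 1 + s * a := by
          have : 0 < (1 + s * a) * E := lt_of_lt_of_le (by positivity) hlin
          exact pos_of_mul_pos_left this hE0.le
        have hyn : ‖y‖ ≤ Real.sqrt r := Real.le_sqrt_of_sq_le hy
        have e4 : Real.sqrt r = Real.sqrt (1 + η) * Real.sqrt (2 / n) := by
          rw [hr, Real.sqrt_mul (by positivity)]
        have e5 : Real.sqrt (2 * (Real.pi * Real.exp 1) / n) = E * Real.sqrt (2 / n) := by
          rw [hE, ← Real.sqrt_mul (by positivity)]; congr 1; ring
        rw [e5] at hw
        have e6 : 1 + η = Real.sqrt (1 + η) * Real.sqrt (1 + η) :=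
          (Real.mul_self_sqrt (by positivity)).symm
        have hq : 0 < Real.sqrt (1 + η) := by positivity
        calc 2 * (1 - s * b) * ‖y‖ ≤ 2 * (1 - s * b) * (Real.sqrt (1 + η) * Real.sqrt (2 / n)) := by
              rw [← e4]; gcongr
          _ = ((1 + η) * (2 * (1 - s * b))) * (1 / Real.sqrt (1 + η) * Real.sqrt (2 / n)) := by
              nth_rw 2 [e6]; field_simp
          _ ≤ ((1 + s * a) * E) * (1 / Real.sqrt (1 + η) * Real.sqrt (2 / n)) := by gcongr
          _ = (1 + s * a) * (1 / Real.sqrt (1 + η) * (E * Real.sqrt (2 / n))) := by ring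
          _ ≤ _ := by gcongr
      have hsub : (2 * (1 - s * b)) • (B1 n ∩ {x | ‖x‖ ^ 2 ≤ r}) ⊆ polarSection a b n s := by
        rintro _ ⟨y, ⟨hy1, hy2⟩, rfl⟩
        have hp : 0 < 2 * (1 - s * b) := by positivity
        refine subset_section a b n s w hw0 hwdef _ ?_ ?_
        · simp only [norm_smul, Real.norm_eq_abs, abs_of_pos hp]
          exact hnorm y hy2
        · simp only [PiLp.smul_apply, smul_eq_mul, abs_mul, ← Finset.mul_sum, abs_of_pos hp]
          have : ∑ i, |y i| ≤ 1 := hy1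
          nlinarith
      have hfin := measure_ne_top_of_subset (section_subset a b n s hT1) hscfin
      have hle := ENNReal.toReal_mono hfin (measure_mono (μ := volume) hsub)
      rw [hsc, ENNReal.toReal_mul, ENNReal.toReal_ofReal (by positivity), vol_B1r] at hle
      have hhm := half_mass n hn0 η hη0 hnn r le_rfl
      rw [measureReal_def, measureReal_def, ← vol_B1] at hhm
      refine le_trans ?_ hle
      rw [Real.rpow_sub_one two_ne_zero, Real.rpow_natCast]
      calc _ = (2 * (1 - s * b)) ^ n * ((volume (B1 n)).toReal / 2) := by rw [mul_pow]; ring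
        _ ≤ _ := by gcongr
  · have := ENNReal.toReal_mono hscfin (measure_mono (μ := volume) (section_subset a b n s hT1))
    rwa [hsc, ENNReal.toReal_mul, ENNReal.toReal_ofReal (by positivity), mul_pow] at this
end

section
/- Let a, b > 0, let K = B₂ⁿ / vol_n(B₂ⁿ)^{1/n}, L = (1/2) B_∞ⁿ, and M_n = co[(K, −a), (L, b)] ⊆ ℝ^{n+1}. Then for every γ > 0 there is n₀ such that for all n ≥ n₀ and all s with −1/a ≤ s ≤ −(√e − 1)/(b + a√e) − γ, one has (1/2) (1 + s a)^n vol_n(B₂ⁿ)² ≤ vol_n(M_n^∘(s)) ≤ (1 + s a)^n vol_n(B₂ⁿ)². -/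
open MeasureTheory
open scoped Pointwise RealInnerProductSpace

theorem gamma_lower {x : ℝ} (hx : 0 < x) : x ^ x * Real.exp (-x) ≤ Real.Gamma (x + 1) := by
  rw [Real.Gamma_eq_integral (by linarith)]
  have hi := Real.GammaIntegral_convergent (s := x + 1) (by linarith)
  simp only [add_sub_cancel_right] at hi ⊢
  have hsub : Set.Ioi x ⊆ Set.Ioi (0:ℝ) := Set.Ioi_subset_Ioi hx.le
  calc x ^ x * Real.exp (-x) = ∫ t in Set.Ioi x, Real.exp (-t) * x ^ x := by
        rw [integral_mul_const, integral_exp_neg_Ioi, mul_comm]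
    _ ≤ ∫ t in Set.Ioi x, Real.exp (-t) * t ^ x := by
        refine setIntegral_mono_on ((integrableOn_exp_neg_Ioi x).mul_const _) (hi.mono_set hsub) measurableSet_Ioi ?_
        intro t ht
        have : x ^ x ≤ t ^ x := Real.rpow_le_rpow hx.le (le_of_lt ht) hx.le
        gcongr
    _ ≤ _ := by
        refine setIntegral_mono_set hi ?_ hsub.eventuallyLE
        refine (ae_restrict_iff' measurableSet_Ioi).2 (Filter.Eventually.of_forall fun t ht => ?_)
        have : (0:ℝ) < t := ht
        simp only [Pi.zero_apply]
        positivity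

theorem vroot_bound {n : ℕ} (hn : 1 ≤ n) :
    (volume (Metric.closedBall (0 : EuclideanSpace ℝ (Fin n)) 1)).toReal ^ (1 / (n : ℝ)) * √n
      ≤ √(2 * Real.pi * Real.exp 1) := by
  have : Nonempty (Fin n) := ⟨⟨0, hn⟩⟩
  have hn0 : (0:ℝ) < n := by exact_mod_cast hn
  rw [EuclideanSpace.volume_closedBall]
  simp only [ENNReal.ofReal_one, one_pow, one_mul, Fintype.card_fin]
  have hG : 0 < Real.Gamma ((n:ℝ) / 2 + 1) := Real.Gamma_pos_of_pos (by positivity)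
  rw [ENNReal.toReal_ofReal (by positivity)]
  rw [← le_div_iff₀ (by positivity), one_div]
  rw [Real.rpow_inv_le_iff_of_pos (by positivity) (by positivity) (by positivity)]
  rw [Real.rpow_natCast, div_le_iff₀ hG]
  have hg := gamma_lower (x := (n:ℝ)/2) (by positivity)
  refine le_trans (le_of_eq ?_) (mul_le_mul_of_nonneg_left hg (by positivity))
  have e1 : ((n:ℝ)/2) ^ ((n:ℝ)/2) = √((n:ℝ)/2) ^ n := by
    rw [Real.sqrt_eq_rpow, ← Real.rpow_natCast, ← Real.rpow_mul (by positivity)]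
    congr 1; ring
  have e2 : Real.exp (-((n:ℝ)/2)) = √(Real.exp (-1)) ^ n := by
    rw [Real.sqrt_eq_rpow, ← Real.rpow_natCast, ← Real.rpow_mul (by positivity), ← Real.exp_mul]
    congr 1; ring
  rw [e1, e2, ← mul_pow, ← mul_pow, ← Real.sqrt_div (by positivity), ← Real.sqrt_mul (by positivity), ← Real.sqrt_mul (by positivity)]
  congr 2
  rw [Real.exp_neg]
  field_simp


open ProbabilityTheory

theorem le_of_sq_le_sq_aux (x y : ℝ) (hy : 0 ≤ y) (h : x ^ 2 ≤ y ^ 2) : x ≤ y :=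
  le_trans (le_abs_self x) (abs_le_of_sq_le_sq h hy)

theorem pi_gauss (n : ℕ) : Measure.pi (fun _ : Fin n => gaussianReal 0 1) =
    (volume : Measure (Fin n → ℝ)).withDensity
      (fun x => ENNReal.ofReal (∏ i, gaussianPDFReal 0 1 (x i))) := by
  refine Measure.pi_eq fun s hs => ?_
  rw [withDensity_apply _ (MeasurableSet.univ_pi hs), volume_pi, Measure.restrict_pi_pi,
    ← ofReal_integral_eq_lintegral_ofReal, integral_fintype_prod_eq_prod, ENNReal.ofReal_prod_of_nonneg]
  · refine Finset.prod_congr rfl fun i _ => ?_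
    rw [gaussianReal_apply_eq_integral _ one_ne_zero]
  · intro i _
    exact integral_nonneg fun x => gaussianPDFReal_nonneg _ _ _
  · exact Integrable.fintype_prod fun i => (integrable_gaussianPDFReal 0 1).restrict
  · exact Filter.Eventually.of_forall fun x => Finset.prod_nonneg fun i _ => gaussianPDFReal_nonneg _ _ _

theorem gauss_abs : ∫ x, |x| ∂(gaussianReal 0 1) = √(2 / Real.pi) := by
  rw [integral_gaussianReal_eq_integral_smul one_ne_zero]
  have h := integral_comp_abs (f := fun x => gaussianPDFReal 0 1 x * x)
  have e : ∀ x : ℝ, gaussianPDFReal 0 1 |x| = gaussianPDFReal 0 1 x := by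
    intro x; simp [gaussianPDFReal]
  simp only [e] at h
  simp only [smul_eq_mul]
  rw [h]
  have h2 := integral_rpow_mul_exp_neg_mul_rpow (p := 2) (q := 1) (b := 1/2) (by norm_num) (by norm_num) (by norm_num)
  have : ∫ x in Set.Ioi (0:ℝ), gaussianPDFReal 0 1 x * x = (√(2 * Real.pi))⁻¹ * 1 := by
    have h3 : ∫ x in Set.Ioi (0:ℝ), x ^ (1:ℝ) * Real.exp (-(1/2) * x ^ (2:ℝ)) = 1 := by
      rw [h2]
      norm_num [Real.rpow_neg_one]
    rw [← h3, ← integral_const_mul]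
    refine setIntegral_congr_fun measurableSet_Ioi fun x _ => ?_
    simp only [gaussianPDFReal, Real.rpow_one, Real.rpow_two]
    simp only [NNReal.coe_one, sub_zero, mul_one]
    rw [show -x^2/2 = -(1/2)*x^2 by ring]; ring
  rw [this]
  rw [Real.sqrt_mul (by positivity), Real.sqrt_div (by positivity)]
  have := Real.sqrt_pos.2 Real.pi_pos
  field_simp
  norm_num

theorem gauss_sq : ∫ x, x^2 ∂(gaussianReal 0 1) = 1 := by
  have h := variance_fun_id_gaussianReal (μ := 0) (v := 1)
  rw [variance_of_integral_eq_zero (by fun_prop) (by simp)] at h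
  simpa using h

theorem cheb (ν : Measure ℝ) [IsProbabilityMeasure ν] (f : ℝ → ℝ) (hf : MemLp f 2 ν) {ε : ℝ} (hε : 0 < ε) :
    ∃ N : ℕ, ∀ n ≥ N, (Measure.pi (fun _ : Fin n => ν)) {x | n * ε ≤ |∑ i, f (x i) - n * ∫ y, f y ∂ν|} ≤ 1/4 := by
  obtain ⟨N, hN⟩ := exists_nat_gt (4 * Var[f; ν] / ε^2)
  refine ⟨N + 1, fun n hn => ?_⟩
  have hn0 : (0:ℝ) < n := by exact_mod_cast (by omega : 0 < n)
  have hX : MemLp (∑ i : Fin n, fun x : Fin n → ℝ => f (x i)) 2 (Measure.pi (fun _ : Fin n => ν)) := by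
    refine memLp_finsetSum' _ fun i _ => ?_
    exact hf.comp_measurePreserving (measurePreserving_eval (fun _ : Fin n => ν) i)
  have h := meas_ge_le_variance_div_sq hX (c := n * ε) (by positivity)
  rw [variance_sum_pi (fun i => hf)] at h
  have hE : ∫ x, (∑ i : Fin n, fun x : Fin n → ℝ => f (x i)) x ∂(Measure.pi (fun _ : Fin n => ν)) = n * ∫ y, f y ∂ν := by
    simp only [Finset.sum_apply]
    rw [integral_finsetSum]
    · have : ∀ i : Fin n, ∫ x : Fin n → ℝ, f (x i) ∂(Measure.pi (fun _ : Fin n => ν)) = ∫ y, f y ∂ν := fun i =>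
        integral_comp_eval (μ := fun _ : Fin n => ν) hf.aestronglyMeasurable
      simp [this]
    · intro i _
      exact (hf.comp_measurePreserving (measurePreserving_eval (fun _ : Fin n => ν) i)).integrable (by norm_num)
  rw [hE] at h
  simp only [Finset.sum_apply] at h
  refine h.trans ?_
  rw [show (1/4 : ENNReal) = ENNReal.ofReal (1/4) by
    rw [ENNReal.ofReal_div_of_pos (by norm_num)]; norm_num]
  apply ENNReal.ofReal_le_ofReal
  have hN' : 4 * Var[f; ν] / ε^2 < n := hN.trans (by exact_mod_cast (by omega : N < n))
  rw [div_lt_iff₀ (by positivity)] at hN'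
  simp only [Finset.sum_const, Finset.card_univ, Fintype.card_fin, nsmul_eq_mul]
  rw [div_le_iff₀ (by positivity)]
  nlinarith

theorem cone_ball {n : ℕ} (hn : 1 ≤ n) (C : Set (EuclideanSpace ℝ (Fin n)))
    (hC : ∀ r : ℝ, 0 < r → ∀ x ∈ C, r • x ∈ C) {R : ℝ} (hR : 0 ≤ R) :
    volume (C ∩ Metric.ball 0 R) = ENNReal.ofReal (R ^ n) * volume (C ∩ Metric.ball 0 1) := by
  rcases hR.eq_or_lt with rfl | hR
  · simp [zero_pow (by omega : n ≠ 0)]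
  have : C ∩ Metric.ball 0 R = R • (C ∩ Metric.ball 0 1) := by
    ext x
    rw [Set.mem_smul_set_iff_inv_smul_mem₀ hR.ne']
    simp only [Set.mem_inter_iff, mem_ball_zero_iff, norm_smul, norm_inv, Real.norm_eq_abs, abs_of_pos hR]
    rw [inv_mul_lt_iff₀ hR, mul_one]
    refine and_congr_left fun _ => ⟨fun h => hC _ (by positivity) _ h, fun h => ?_⟩
    simpa [smul_smul, hR.ne'] using hC R hR _ h
  rw [this, Measure.addHaar_smul, finrank_euclideanSpace, Fintype.card_fin, abs_of_pos (by positivity)]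

theorem cone_int (n : ℕ) (hn : 1 ≤ n) : ∃ A : ENNReal, ∀ C : Set (EuclideanSpace ℝ (Fin n)),
    MeasurableSet C → (∀ r : ℝ, 0 < r → ∀ x ∈ C, r • x ∈ C) →
    ∫⁻ x in C, ENNReal.ofReal (Real.exp (-‖x‖^2/2)) = A * volume (C ∩ Metric.ball 0 1) := by
  refine ⟨∫⁻ t in Set.Ioi (0:ℝ), ENNReal.ofReal (√(-2 * Real.log t) ^ n), fun C hm hC => ?_⟩
  rw [lintegral_eq_lintegral_meas_lt]
  · rw [← lintegral_mul_const' _ _ (ne_of_lt ((measure_mono Set.inter_subset_right).trans_lt measure_ball_lt_top))]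
    refine setLIntegral_congr_fun measurableSet_Ioi fun t ht => ?_
    have ht : (0:ℝ) < t := ht
    rw [← cone_ball hn C hC (Real.sqrt_nonneg _), Measure.restrict_apply' hm, Set.inter_comm]
    congr 2
    ext x
    simp only [Set.mem_ofPred_eq, mem_ball_zero_iff]
    rw [← Real.log_lt_iff_lt_exp ht, Real.lt_sqrt (norm_nonneg _)]
    constructor <;> intro h <;> linarith
  · exact Filter.Eventually.of_forall fun x => (Real.exp_pos _).le
  · fun_prop

theorem gauss_cone (n : ℕ) (hn : 1 ≤ n) : ∃ A : ENNReal, ∀ C : Set (EuclideanSpace ℝ (Fin n)),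
    MeasurableSet C → (∀ r : ℝ, 0 < r → ∀ x ∈ C, r • x ∈ C) →
    Measure.pi (fun _ : Fin n => gaussianReal 0 1) ((WithLp.toLp 2) ⁻¹' C) = A * volume (C ∩ Metric.ball 0 1) := by
  obtain ⟨A, hA⟩ := cone_int n hn
  refine ⟨ENNReal.ofReal ((√(2 * Real.pi))⁻¹ ^ n) * A, fun C hm hC => ?_⟩
  have hmp := PiLp.volume_preserving_toLp (Fin n)
  rw [pi_gauss, withDensity_apply _ (hmp.measurable hm), mul_assoc, ← hA C hm hC,
    ← lintegral_const_mul' _ _ ENNReal.ofReal_ne_top,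
    ← hmp.setLIntegral_comp_preimage hm (by fun_prop)]
  refine lintegral_congr fun x => ?_
  rw [← ENNReal.ofReal_mul (by positivity)]
  congr 1
  simp only [gaussianPDFReal, NNReal.coe_one, sub_zero, mul_one, Finset.prod_mul_distrib,
    Finset.prod_const, Finset.card_univ, Fintype.card_fin, ← Real.exp_sum]
  congr 2
  rw [EuclideanSpace.norm_sq_eq]
  simp [← Finset.sum_div, Finset.sum_neg_distrib]

theorem half_cone {n : ℕ} (hn : 1 ≤ n) (C : Set (EuclideanSpace ℝ (Fin n)))
    (hm : MeasurableSet C) (hC : ∀ r : ℝ, 0 < r → ∀ x ∈ C, r • x ∈ C)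
    (h : 1/2 ≤ Measure.pi (fun _ : Fin n => gaussianReal 0 1) ((WithLp.toLp 2) ⁻¹' C)) :
    1/2 * volume (Metric.ball (0 : EuclideanSpace ℝ (Fin n)) 1) ≤ volume (C ∩ Metric.ball 0 1) := by
  obtain ⟨A, hA⟩ := gauss_cone n hn
  have h1 := hA Set.univ MeasurableSet.univ (by simp)
  simp only [Set.preimage_univ, measure_univ, Set.univ_inter] at h1
  rw [hA C hm hC] at h
  calc 1/2 * volume (Metric.ball (0 : EuclideanSpace ℝ (Fin n)) 1)
      ≤ (A * volume (C ∩ Metric.ball 0 1)) * volume (Metric.ball (0 : EuclideanSpace ℝ (Fin n)) 1) := by gcongr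
    _ = (A * volume (Metric.ball (0 : EuclideanSpace ℝ (Fin n)) 1)) * volume (C ∩ Metric.ball 0 1) := by ring
    _ = _ := by rw [← h1, one_mul]

theorem half_l1 {δ : ℝ} (hδ : 0 < δ) : ∃ N : ℕ, ∀ n ≥ N,
    1/2 * volume (Metric.ball (0 : EuclideanSpace ℝ (Fin n)) 1) ≤
      volume ({x : EuclideanSpace ℝ (Fin n) | ∑ i, |x i| ≤ (1 + δ) * √(2 / Real.pi) * √n * ‖x‖} ∩ Metric.ball 0 1) := by
  set m := √(2 / Real.pi) with hmdef
  have hm0 : 0 < m := by positivity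
  obtain ⟨ε, hε, hε1, hε2⟩ : ∃ ε : ℝ, 0 < ε ∧ ε < 1 ∧ m + ε ≤ (1 + δ) * m * (1 - ε) := by
    refine ⟨δ * m / (1 + (1 + δ) * m + δ * m), by positivity, ?_, ?_⟩
    · rw [div_lt_one (by positivity)]; nlinarith [mul_pos hδ hm0]
    · have hD : 0 < 1 + (1 + δ) * m + δ * m := by positivity
      have : δ * m / (1 + (1 + δ) * m + δ * m) * (1 + (1 + δ) * m) ≤ δ * m := by
        rw [div_mul_eq_mul_div, div_le_iff₀ hD]
        have := mul_pos hδ hm0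
        nlinarith
      linarith
  have hid : MemLp (fun x : ℝ => x) 2 (gaussianReal 0 1) := memLp_id_gaussianReal' 2 (by norm_num)
  have hsq : MemLp (fun x : ℝ => x ^ 2) 2 (gaussianReal 0 1) := by
    have h4 : MemLp (fun x : ℝ => x) 4 (gaussianReal 0 1) := memLp_id_gaussianReal' 4 (by norm_num)
    have : ENNReal.HolderTriple 4 4 2 := ⟨by
      rw [← ENNReal.toReal_eq_toReal_iff' (by simp) (by simp), ENNReal.toReal_add (by simp) (by simp)]
      norm_num⟩
    simpa [pow_two] using h4.mul' (r := 2) h4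
  obtain ⟨N1, h1⟩ := cheb (gaussianReal 0 1) (fun x => |x|) hid.abs hε
  obtain ⟨N2, h2⟩ := cheb (gaussianReal 0 1) (fun x => x^2) hsq hε
  refine ⟨N1 + N2 + 1, fun n hn => ?_⟩
  have hn1 : 1 ≤ n := by omega
  specialize h1 n (by omega)
  specialize h2 n (by omega)
  have hn0 : (0:ℝ) < n := by exact_mod_cast hn1
  rw [gauss_abs] at h1
  rw [gauss_sq] at h2
  have hms : MeasurableSet {x : EuclideanSpace ℝ (Fin n) | ∑ i, |x i| ≤ (1 + δ) * m * √n * ‖x‖} :=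
    measurableSet_le (by fun_prop) (by fun_prop)
  refine half_cone hn1 _ hms ?_ ?_
  · intro r hr x hx
    simp only [Set.mem_ofPred_eq, PiLp.smul_apply, smul_eq_mul, abs_mul, abs_of_pos hr, norm_smul, Real.norm_eq_abs, ← Finset.mul_sum] at hx ⊢
    nlinarith
  · set P := Measure.pi (fun _ : Fin n => gaussianReal 0 1)
    set S := WithLp.toLp 2 ⁻¹' {x : EuclideanSpace ℝ (Fin n) | ∑ i, |x i| ≤ (1 + δ) * m * √n * ‖x‖} with hS
    have hcomp : P Sᶜ ≤ 1/4 + 1/4 := by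
      refine (measure_mono ?_).trans ((measure_union_le _ _).trans (add_le_add h1 h2))
      intro x hx
      by_contra hcon
      simp only [Set.mem_union, Set.mem_ofPred_eq, not_or, not_le, abs_lt] at hcon
      obtain ⟨⟨_, ha⟩, ⟨hb, _⟩⟩ := hcon
      apply hx
      simp only [hS, Set.mem_preimage, Set.mem_ofPred_eq]
      have hnorm : √n * (1 - ε) ≤ ‖(WithLp.toLp 2 x : EuclideanSpace ℝ (Fin n))‖ := by
        apply le_of_sq_le_sq_aux _ _ (norm_nonneg _)
        rw [EuclideanSpace.norm_sq_eq, mul_pow, Real.sq_sqrt hn0.le]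
        simp only [Real.norm_eq_abs, sq_abs]
        nlinarith [mul_pos hn0 (mul_pos hε (by linarith : 0 < 1 - ε))]
      calc ∑ i, |x i| ≤ n * (m + ε) := by linarith
        _ ≤ n * ((1 + δ) * m * (1 - ε)) := by gcongr
        _ = (1 + δ) * m * √n * (√n * (1 - ε)) := by
            nth_rewrite 1 [← Real.mul_self_sqrt hn0.le]; ring
        _ ≤ _ := by gcongr
    have hquarter : (1/4 + 1/4 : ENNReal) = 1/2 := by
      rw [← ENNReal.toReal_eq_toReal_iff' (by simp) (by simp), ENNReal.toReal_add (by simp) (by simp)]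
      norm_num
    rw [hquarter] at hcomp
    have hmS : MeasurableSet S := (PiLp.volume_preserving_toLp (Fin n)).measurable hms
    have htot := prob_add_prob_compl (μ := P) hmS
    by_contra hlt
    rw [not_le] at hlt
    have : P S + P Sᶜ < 1/2 + 1/2 := ENNReal.add_lt_add_of_lt_of_le (by finiteness) hlt hcomp
    rw [htot, ENNReal.add_halves] at this
    exact lt_irrefl _ this

theorem polarSection_sup (a b : ℝ) {n : ℕ} {s v : ℝ}
    (hv : v = (volume (Metric.closedBall (0 : EuclideanSpace ℝ (Fin n)) 1)).toReal ^ (1 / (n : ℝ)))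
    (hv0 : 0 < v) (z : EuclideanSpace ℝ (Fin n))
    (h1 : ‖z‖ ≤ (1 + s * a) * v) (h2 : ∑ i, |z i| ≤ 2 * (1 - s * b)) : z ∈ polarSection a b n s := by
  intro y hy
  let H : Set (EuclideanSpace ℝ (Fin n) × ℝ) := {y | ⟪z, y.1⟫ + s * y.2 ≤ 1}
  have hconv : Convex ℝ H := by
    intro p hp q hq α β hα hβ hαβ
    simp only [H, Set.mem_ofPred_eq, Prod.fst_add, Prod.snd_add, Prod.smul_fst, Prod.smul_snd,
      inner_add_right, inner_smul_right, smul_eq_mul] at hp hq ⊢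
    nlinarith
  refine convexHull_min ?_ hconv hy
  rintro ⟨p, t⟩ (⟨hp, ht⟩ | ⟨hp, ht⟩)
  · simp only [Set.mem_singleton_iff] at hp ht
    subst ht
    rw [normBall, ← hv] at hp
    obtain ⟨q, hq, rfl⟩ := hp
    simp only [H, Set.mem_ofPred_eq, inner_smul_right]
    have hq1 : ‖q‖ ≤ 1 := by simpa using hq
    have : ⟪z, q⟫ ≤ (1 + s * a) * v := (real_inner_le_norm z q).trans (by nlinarith [norm_nonneg z, norm_nonneg q])
    have h3 : v⁻¹ * ⟪z, q⟫ ≤ 1 + s * a := by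
      rw [inv_mul_le_iff₀ hv0]; linarith
    linarith
  · simp only [Set.mem_singleton_iff] at hp ht
    subst ht
    obtain ⟨q, hq, rfl⟩ := hp
    simp only [H, Set.mem_ofPred_eq, inner_smul_right]
    have : ⟪z, q⟫ ≤ ∑ i, |z i| := by
      rw [PiLp.inner_apply]
      refine Finset.sum_le_sum fun i _ => ?_
      have hqi : |q i| ≤ 1 := hq i
      refine (le_abs_self _).trans ?_
      rw [RCLike.inner_apply, conj_trivial, abs_mul]
      nlinarith [abs_nonneg (z i)]
    linarith

theorem polarSection_sub (a b : ℝ) {n : ℕ} {s v : ℝ}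
    (hv : v = (volume (Metric.closedBall (0 : EuclideanSpace ℝ (Fin n)) 1)).toReal ^ (1 / (n : ℝ)))
    (hv0 : 0 < v) (hs : 0 ≤ 1 + s * a) :
    polarSection a b n s ⊆ Metric.closedBall 0 ((1 + s * a) * v) := by
  intro z hz
  rw [mem_closedBall_zero_iff]
  rcases eq_or_ne z 0 with rfl | hz0
  · simp; positivity
  have hzn : 0 < ‖z‖ := norm_pos_iff.2 hz0
  have := hz (v⁻¹ • (‖z‖⁻¹ • z), -a) (subset_convexHull ℝ _ (Or.inl ⟨by
    rw [normBall, ← hv]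
    refine Set.smul_mem_smul_set ?_
    simp [norm_smul, hzn.ne'], rfl⟩))
  simp only [inner_smul_right, real_inner_self_eq_norm_sq] at this
  have h2 : v⁻¹ * (‖z‖⁻¹ * ‖z‖ ^ 2) = v⁻¹ * ‖z‖ := by field_simp
  rw [h2] at this
  have h3 : v⁻¹ * ‖z‖ ≤ 1 + s * a := by linarith
  rw [inv_mul_le_iff₀ hv0] at h3
  linarith

theorem polarSection_volume_near_ball_face (a b : ℝ) (ha : 0 < a) (hb : 0 < b) :
    ∀ γ > (0 : ℝ), ∃ n₀ : ℕ, ∀ n ≥ n₀, ∀ s : ℝ,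
      -(1 / a) ≤ s →
      s ≤ -(Real.sqrt (Real.exp 1) - 1) / (b + a * Real.sqrt (Real.exp 1)) - γ →
      (1 / 2 : ℝ) * (1 + s * a) ^ n *
            (volume (Metric.closedBall (0 : EuclideanSpace ℝ (Fin n)) 1)).toReal ^ 2 ≤
          (volume (polarSection a b n s)).toReal ∧
        (volume (polarSection a b n s)).toReal ≤
          (1 + s * a) ^ n *
            (volume (Metric.closedBall (0 : EuclideanSpace ℝ (Fin n)) 1)).toReal ^ 2 := by
  intro γ hγ
  set q := Real.sqrt (Real.exp 1) with hq
  have hq1 : 1 < q := by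
    rw [hq, Real.lt_sqrt (by norm_num)]
    have := Real.add_one_lt_exp (x := 1) (by norm_num)
    linarith
  have hD : 0 < b + a * q := by positivity
  have hδ : 0 < γ * (b + a * q) / q := by positivity
  obtain ⟨N, hN⟩ := half_l1 hδ
  set δ := γ * (b + a * q) / q with hδdef
  refine ⟨N + 1, fun n hn s hs1 hs2 => ?_⟩
  have hn1 : 1 ≤ n := by omega
  have hn0 : (0:ℝ) < n := by exact_mod_cast hn1
  have hw : 0 ≤ 1 + s * a := by
    have := mul_le_mul_of_nonneg_right hs1 ha.le
    have h2 : -(1 / a) * a = -1 := by field_simp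
    linarith
  have hs0 : s ≤ 0 := by
    have : -(q - 1) / (b + a * q) ≤ 0 := div_nonpos_of_nonpos_of_nonneg (by linarith) hD.le
    linarith
  have hkey : (1 + δ) * (1 + s * a) * q ≤ 1 - s * b := by
    have h1 : (s + γ) * (b + a * q) ≤ -(q - 1) := by
      rw [← le_div_iff₀ hD]; linarith
    have h2 : δ * q = γ * (b + a * q) := by rw [hδdef]; field_simp
    have h3 : δ * q * (1 + s * a) ≤ δ * q * 1 := by
      apply mul_le_mul_of_nonneg_left _ (by positivity)
      nlinarith
    nlinarith
  set V := (volume (Metric.closedBall (0 : EuclideanSpace ℝ (Fin n)) 1)).toReal with hV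
  have hV0 : 0 < V := ENNReal.toReal_pos (Metric.measure_closedBall_pos volume _ one_pos).ne' measure_closedBall_lt_top.ne
  set v := V ^ (1 / (n : ℝ)) with hv
  have hv0 : 0 < v := by positivity
  have hvn : v ^ n = V := by
    rw [hv, one_div, Real.rpow_inv_natCast_pow hV0.le (by omega)]
  have hvb : v * √n ≤ √(2 * Real.pi * Real.exp 1) := vroot_bound hn1
  set r := (1 + s * a) * v with hr
  have hr0 : 0 ≤ r := by positivity
  have hrn : r ^ n = (1 + s * a) ^ n * V := by rw [hr, mul_pow, hvn]
  have hsub := polarSection_sub a b (s := s) hv hv0 hw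
  have hfin : volume (polarSection a b n s) ≠ ⊤ :=
    ne_of_lt ((measure_mono hsub).trans_lt measure_closedBall_lt_top)
  constructor
  · set C := {x : EuclideanSpace ℝ (Fin n) | ∑ i, |x i| ≤ (1 + δ) * √(2 / Real.pi) * √n * ‖x‖}
    have hsup : r • (C ∩ Metric.ball 0 1) ⊆ polarSection a b n s := by
      rintro _ ⟨x, ⟨hx, hx1⟩, rfl⟩
      have hx : ∑ i, |x i| ≤ (1 + δ) * √(2 / Real.pi) * √n * ‖x‖ := hx
      have hx1 : ‖x‖ ≤ 1 := by simpa using (mem_ball_zero_iff.1 hx1).le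
      apply polarSection_sup a b hv hv0
      · simp only [norm_smul, Real.norm_eq_abs, abs_of_nonneg hr0]
        rw [← hr]
        nlinarith
      · simp only [PiLp.smul_apply, smul_eq_mul, abs_mul, abs_of_nonneg hr0, ← Finset.mul_sum]
        have e : √(2 / Real.pi) * √(2 * Real.pi * Real.exp 1) = 2 * q := by
          rw [← Real.sqrt_mul (by positivity)]
          rw [show 2 / Real.pi * (2 * Real.pi * Real.exp 1) = 2 ^ 2 * Real.exp 1 by
            field_simp]
          rw [Real.sqrt_mul (by positivity), Real.sqrt_sq (by norm_num)]
        calc r * ∑ i, |x i| ≤ r * ((1 + δ) * √(2 / Real.pi) * √n * 1) := by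
              apply mul_le_mul_of_nonneg_left _ hr0
              exact hx.trans (by gcongr)
          _ = (1 + δ) * (1 + s * a) * (√(2 / Real.pi) * (v * √n)) := by rw [hr]; ring
          _ ≤ (1 + δ) * (1 + s * a) * (√(2 / Real.pi) * √(2 * Real.pi * Real.exp 1)) := by gcongr
          _ = 2 * ((1 + δ) * (1 + s * a) * q) := by rw [e]; ring
          _ ≤ _ := by linarith
    have h1 := measure_mono (μ := volume) hsup
    rw [Measure.addHaar_smul, finrank_euclideanSpace, Fintype.card_fin, abs_of_nonneg (by positivity)] at h1
    have h2 := hN n (by omega)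
    rw [← Measure.addHaar_unitClosedBall_eq_addHaar_unitBall] at h2
    have h3 := ENNReal.toReal_mono hfin ((mul_le_mul_right h2 (ENNReal.ofReal (r ^ n))).trans h1)
    rw [ENNReal.toReal_mul, ENNReal.toReal_ofReal (by positivity), ENNReal.toReal_mul, ← hV, hrn] at h3
    norm_num at h3
    refine le_trans (le_of_eq ?_) h3
    ring
  · have h1 := ENNReal.toReal_mono measure_closedBall_lt_top.ne (measure_mono (μ := volume) hsub)
    rw [Measure.addHaar_closedBall' _ _ hr0, finrank_euclideanSpace, Fintype.card_fin, ENNReal.toReal_mul,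
      ENNReal.toReal_ofReal (by positivity), ← hV, hrn] at h1
    refine h1.trans (le_of_eq ?_)
    ring
end
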